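/- Every series parallel interval order R on a finite n-element set X admits a preorder linear extension, i.e. there exists a bijection λ : X → {1,...,n} such that x R y implies λ(x) < λ(y) and x Z(R) y implies λ(x) < λ(y). -/

import Mathlib

/-- `x` and `y` are incomparable w.r.t. the relation `R`. -/
def Incomp {X : Type*} (R : X → X → Prop) (x y : X) : Prop :=
  ¬ R x y ∧ ¬ R y x

/-- The auxiliary relation `Z(R)`: `x Z y` iff `x` and `y` are `R`-incomparable and there
exists `z` which is `R`-comparable with `y` and `R`-incomparable with `x`. -/
def Zrel {X : Type*} (R : X → X → Prop) (x y : X) : Prop :=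
  Incomp R x y ∧ ∃ z, (R z y ∨ R y z) ∧ Incomp R z x

/-- `R` is (the strict order relation of) a series parallel interval order:
a strict partial order with no induced `2+2` and no induced fence of order four. -/
def IsSPIO {X : Type*} (R : X → X → Prop) : Prop :=
  (∀ x, ¬ R x x) ∧ (∀ x y z, R x y → R y z → R x z) ∧
  (¬ ∃ a b c d : X, a ≠ b ∧ a ≠ c ∧ a ≠ d ∧ b ≠ c ∧ b ≠ d ∧ c ≠ d ∧
      R a b ∧ R c d ∧ Incomp R a c ∧ Incomp R a d ∧ Incomp R b c ∧ Incomp R b d) ∧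
  (¬ ∃ a b c d : X, a ≠ b ∧ a ≠ c ∧ a ≠ d ∧ b ≠ c ∧ b ≠ d ∧ c ≠ d ∧
      R a b ∧ R c b ∧ R c d ∧ Incomp R a c ∧ Incomp R a d ∧ Incomp R b d)

/-- `lam` is a preorder linear extension of `R`: a bijective labelling by `Fin n`
compatible with both `R` and `Z(R)`. -/
def IsPLE {X : Type*} {n : ℕ} (R : X → X → Prop) (lam : X ≃ Fin n) : Prop :=
  (∀ x y, R x y → lam x < lam y) ∧ (∀ x y, Zrel R x y → lam x < lam y)

/-- `x` and `y` are order equivalent in `R`: some order automorphism maps `x` to `y`. -/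
def OrderEquivElems {X : Type*} (R : X → X → Prop) (x y : X) : Prop :=
  ∃ f : X ≃ X, (∀ a b, R a b ↔ R (f a) (f b)) ∧ f x = y

theorem Incomp.symm {X : Type*} {R : X → X → Prop} {x y : X} (h : Incomp R x y) :
    Incomp R y x :=
  And.symm h

/-- In a series parallel interval order, `Zrel R x y` implies that every element incomparable
with `y` is incomparable with `x`. -/
theorem Zrel.incomp_of_incomp {X : Type*} {R : X → X → Prop} (hR : IsSPIO R) {x y w : X}
    (h : Zrel R x y) (hw : Incomp R w y) : Incomp R w x := by
  obtain ⟨hirr, htr, h22, hN⟩ := hR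
  obtain ⟨hxy, z, hzy, hzx⟩ := h
  unfold Incomp at *
  by_contra hwx
  have hwx : R w x ∨ R x w := by tauto
  have hwy_ne : w ≠ y := by rintro rfl; tauto
  have hzx_ne : z ≠ x := by rintro rfl; tauto
  have hxy_ne : x ≠ y := by rintro rfl; tauto
  have hwx_ne : w ≠ x := by rintro rfl; have := hirr w; tauto
  have hzy_ne : z ≠ y := by rintro rfl; have := hirr z; tauto
  have hwz_ne : w ≠ z := by rintro rfl; tauto
  by_cases hwz : R w z ∨ R z w
  · rcases hzy with hzy | hyz
    · have hzw : R z w := by grind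
      have hxw : R x w := by grind
      exact hN ⟨x, w, z, y, by grind⟩
    · have hwz : R w z := by grind
      have hwx : R w x := by grind
      exact hN ⟨y, z, w, x, by grind⟩
  · rcases hzy with hzy | hyz <;> rcases hwx with hwx | hxw
    · exact h22 ⟨z, y, w, x, by grind⟩
    · exact h22 ⟨z, y, x, w, by grind⟩
    · exact h22 ⟨y, z, w, x, by grind⟩
    · exact h22 ⟨y, z, x, w, by grind⟩

/-- For a series parallel interval order `R`, the union of `R` and `Zrel R` is a strict partial
order. -/
theorem IsSPIO.isStrictOrder_or_zrel {X : Type*} {R : X → X → Prop} (hR : IsSPIO R) :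
    IsStrictOrder X (fun x y => R x y ∨ Zrel R x y) where
  irrefl x := by
    rintro (h | ⟨-, z, hz, hzx⟩)
    · exact hR.1 x h
    · unfold Incomp at hzx
      tauto
  trans x y z := by
    have htr := hR.2.1
    rintro (hxy | hxy) (hyz | hyz)
    · exact Or.inl (htr x y z hxy hyz)
    · left
      by_contra hxz
      have hzx : ¬ R z x := fun h => hyz.1.2 (htr z x y h hxy)
      exact (hyz.incomp_of_incomp hR ⟨hxz, hzx⟩).1 hxy
    · by_cases hxz : R x z
      · exact Or.inl hxz
      · have hzx : ¬ R z x := fun h => hxy.1.2 (htr y z x hyz h)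
        exact Or.inr ⟨⟨hxz, hzx⟩, y, Or.inl hyz, hxy.1.symm⟩
    · obtain ⟨w, hwz, hwy⟩ := hyz.2
      exact Or.inr ⟨(hxy.incomp_of_incomp hR hyz.1.symm).symm, w, hwz,
        hxy.incomp_of_incomp hR hwy⟩

/-- A strict order on a finite type with `n` elements has a linear extension by `Fin n`. -/
theorem exists_equiv_fin_of_isStrictOrder {X : Type*} [Fintype X] {n : ℕ}
    (hcard : Fintype.card X = n) (T : X → X → Prop) [IsStrictOrder X T] :
    ∃ e : X ≃ Fin n, ∀ x y, T x y → e x < e y := by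
  let _ : PartialOrder X := partialOrderOfSO T
  let _ : Fintype (LinearExtension X) := ‹Fintype X›
  let e : Fin n ≃o LinearExtension X := Fintype.orderIsoFinOfCardEq (LinearExtension X) hcard
  refine ⟨e.symm.toEquiv, fun x y hxy => ?_⟩
  have hlt : x < y := hxy
  have hle : toLinearExtension x ≤ toLinearExtension y := toLinearExtension.monotone hlt.le
  exact e.symm.strictMono (lt_of_le_of_ne hle hlt.ne)

/-- Every series parallel interval order on a finite `n`-element set admits a preorder
linear extension. -/
theorem spio_exists_ple {X : Type*} [Fintype X] {n : ℕ} (hcard : Fintype.card X = n)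
    (R : X → X → Prop) (hR : IsSPIO R) :
    ∃ lam : X ≃ Fin n, IsPLE R lam := by
  have := hR.isStrictOrder_or_zrel
  obtain ⟨e, he⟩ :=
    exists_equiv_fin_of_isStrictOrder hcard (fun x y => R x y ∨ Zrel R x y)
  exact ⟨e, fun x y h => he x y (Or.inl h), fun x y h => he x y (Or.inr h)⟩
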